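/- Assume f satisfies (f1), (f2) and q satisfies (q1), (q2), and let u be a solution of (E). Then there exists a constant C > 0 such that |u(r)| + |u′(r)| ≤ C for all r ≥ 0. -/

import Mathlib

open Set Filter MeasureTheory Topology

noncomputable section

/-- `F(s) = ∫₀ˢ f(t) dt`. -/
def Fint (f : ℝ → ℝ) (s : ℝ) : ℝ := ∫ t in (0:ℝ)..s, f t

/-- `s ∈ (−c, c)` where `c ∈ (0, ∞]` is viewed as an extended real. -/
def InCC (c : EReal) (s : ℝ) : Prop := -c < (s : EReal) ∧ (s : EReal) < c

/-- A solution of equation (E):  `u'' + (q'/q) u' + f(u) = 0` on `(0,∞)`,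
`u` with values in `(−c,c)`, `C¹` on `[0,∞)`, twice differentiable on `(0,∞)`,
and `u'(0) = 0`. -/
structure IsSolutionE (c : EReal) (f q u : ℝ → ℝ) : Prop where
  mem : ∀ r : ℝ, 0 ≤ r → InCC c (u r)
  c1 : ContDiffOn ℝ 1 u (Ici (0:ℝ))
  diff2 : ∀ r : ℝ, 0 < r → DifferentiableAt ℝ (deriv u) r
  ode : ∀ r : ℝ, 0 < r →
    deriv (deriv u) r + (deriv q r / q r) * deriv u r + f (u r) = 0
  d0 : deriv u 0 = 0

/-- Condition (f1). -/
def CondF1 (c : EReal) (f : ℝ → ℝ) (b β : ℝ) : Prop :=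
  (∀ s : ℝ, f (-s) = - f s) ∧ f 0 = 0 ∧
  0 < b ∧ b < β ∧ (β : EReal) < c ∧
  (∀ s : ℝ, b < s → (s : EReal) < c → 0 < f s) ∧
  (∀ s : ℝ, s ∈ Icc (0:ℝ) b → f s ≤ 0) ∧
  (∃ s ∈ Icc (0:ℝ) b, f s ≠ 0) ∧
  Fint f β = 0

/-- Condition (f2). -/
def CondF2 (c : EReal) (f : ℝ → ℝ) : Prop :=
  ContDiffOn ℝ 1 f {s : ℝ | 0 < s ∧ (s : EReal) < c} ∧
  IntegrableOn (deriv f) (Ioo (0:ℝ) 1)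

/-- Condition (q1). -/
def CondQ1 (q : ℝ → ℝ) : Prop :=
  ContDiffOn ℝ 1 q (Ioi (0:ℝ)) ∧
  (∀ r : ℝ, 0 < r → 0 < q r ∧ 0 < deriv q r) ∧
  q 0 = 0 ∧ ContinuousWithinAt q (Ici (0:ℝ)) 0

/-- Condition (q2). -/
def CondQ2 (q : ℝ → ℝ) : Prop :=
  StrictAntiOn (fun r => deriv q r / q r) (Ioi (0:ℝ))

/-- `Q(r) = ∫₀ʳ q(s) ds`. -/
def Qint (q : ℝ → ℝ) (r : ℝ) : ℝ := ∫ s in (0:ℝ)..r, q s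

/-- `H = (Q/q)'`. -/
def Hfun (q : ℝ → ℝ) (r : ℝ) : ℝ := deriv (fun t => Qint q t / q t) r

/-- Condition (q3), with `Hinf = H∞`. -/
def CondQ3 (q : ℝ → ℝ) (Hinf : ℝ) : Prop :=
  AntitoneOn (Hfun q) (Ioi (0:ℝ)) ∧
  (∃ H0 : ℝ, Tendsto (Hfun q) (nhdsWithin 0 (Ioi 0)) (nhds H0) ∧ H0 < 1/2) ∧
  Tendsto (Hfun q) atTop (nhds Hinf) ∧ 0 < Hinf ∧
  MonotoneOn (fun r => q r * (Hfun q r - Hinf)) (Ioi (0:ℝ))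

/-- Condition (f3). -/
def CondF3 (c : EReal) (f : ℝ → ℝ) (β Hinf : ℝ) : Prop :=
  ∀ s : ℝ, β < s → (s : EReal) < c →
    (1 - 2 * Hinf) / 2 ≤ deriv (fun t => Fint f t / f t) s

/-- `h(r) = q(r) ∫_r^∞ ds / q(s)`. -/
def hfun (q : ℝ → ℝ) (r : ℝ) : ℝ := q r * ∫ s in Ioi r, 1 / q s

/-- Condition (q4), with `linf = ℓ∞`. -/
def CondQ4 (q : ℝ → ℝ) (linf : ℝ) : Prop :=
  IntegrableOn (fun r => 1 / q r) (Ioi (1:ℝ)) ∧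
  ¬ IntegrableOn (fun r => 1 / q r) (Ioo (0:ℝ) 1) ∧
  (∀ r : ℝ, 0 < r → 0 < deriv (hfun q) r) ∧
  AntitoneOn (deriv (hfun q)) (Ioi (0:ℝ)) ∧
  Tendsto (deriv (hfun q)) atTop (nhds linf) ∧ 0 < linf

/-- Condition (f4): `s ↦ s f'(s)/f(s)` is decreasing for `s ≥ b`. -/
def CondF4 (c : EReal) (f : ℝ → ℝ) (b : ℝ) : Prop :=
  StrictAntiOn (fun s => s * deriv f s / f s) {s : ℝ | b ≤ s ∧ (s : EReal) < c}

/-- Condition (q5). -/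
def CondQ5 (q : ℝ → ℝ) : Prop :=
  StrictMonoOn (fun r => deriv q r * q r) (Ioi (0:ℝ))

/-- Condition (f5). -/
def CondF5 (c : EReal) (f : ℝ → ℝ) (b : ℝ) : Prop :=
  ∀ s : ℝ, b ≤ s → (s : EReal) < c → deriv f s * (s - b) ≤ f s

/-- Condition (f6). -/
def CondF6 (f : ℝ → ℝ) (β linf : ℝ) : Prop :=
  β * deriv f β / f β ≤ 1 + 2 * linf

/-- `G(r) = (q'/(q h)) ∫₀ʳ h − 1/2`. -/
def Gfun (q : ℝ → ℝ) (r : ℝ) : ℝ :=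
  deriv q r / (q r * hfun q r) * (∫ s in (0:ℝ)..r, hfun q s) - 1/2

/-- Condition (q6), with `Gbar = sup_{r>0} G(r)`. -/
def CondQ6 (q : ℝ → ℝ) (Gbar : ℝ) : Prop :=
  (∀ r : ℝ, 0 < r → 0 ≤ Gfun q r) ∧
  IsLUB (Gfun q '' Ioi (0:ℝ)) Gbar ∧
  MonotoneOn (fun r => Gfun q r * hfun q r / Real.sqrt (∫ s in (0:ℝ)..r, hfun q s))
    (Ioi (0:ℝ))

/-- Condition (q7), with constant `C`. -/
def CondQ7 (q : ℝ → ℝ) (Gbar C : ℝ) : Prop :=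
  Gbar ≤ C ∧ C ≤ 1 ∧
  ∃ a : ℝ, a ∈ Ioo (0:ℝ) 1 ∧
    MonotoneOn (fun r => hfun q r ^ (1 - a) * (C - Gfun q r)) (Ioi (0:ℝ))

/-- Condition (f7). -/
def CondF7 (c : EReal) (f : ℝ → ℝ) (β C : ℝ) : Prop :=
  ∀ s : ℝ, β < s → (s : EReal) < c → C ≤ deriv (fun t => Fint f t / f t) s

/-- `u` has exactly `k` sign changes on `(0,∞)`: there are
`0 = z₀ < z₁ < ⋯ < z_k` such that for `i = 0,…,k` the function `(−1)^i u`
is nonnegative and not identically zero on `[z_i, z_{i+1}]` (with `z_{k+1} = ∞`). -/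
def ExactSignChanges (u : ℝ → ℝ) (k : ℕ) : Prop :=
  ∃ z : ℕ → ℝ, z 0 = 0 ∧ (∀ i, i < k → z i < z (i + 1)) ∧
    ∀ i, i ≤ k →
      (∀ r ∈ (if i < k then Icc (z i) (z (i + 1)) else Ici (z i)),
        0 ≤ (-1 : ℝ) ^ i * u r) ∧
      ∃ r ∈ (if i < k then Icc (z i) (z (i + 1)) else Ici (z i)),
        (-1 : ℝ) ^ i * u r ≠ 0

/-- A first variation `φ` along a solution `u` of (E). -/
structure IsFirstVariation (c : EReal) (f q u φ : ℝ → ℝ) : Prop where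
  c1 : ContDiffOn ℝ 1 φ (Ici (0:ℝ))
  init : φ 0 = 1
  dinit : deriv φ 0 = 0
  diff2 : ∀ r : ℝ, 0 < r → u r ≠ 0 → DifferentiableAt ℝ (deriv φ) r
  ode : ∀ r : ℝ, 0 < r → u r ≠ 0 →
    deriv (deriv φ) r + (deriv q r / q r) * deriv φ r + deriv f (u r) * φ r = 0

/-- The filter of approach to `Z ∈ (0,∞]` from the left. -/
def leftFilter (Z : EReal) : Filter ℝ :=
  if Z = ⊤ then atTop else nhdsWithin Z.toReal (Iio Z.toReal)

/-- `Z₁` for a single solution `w`: the supremum of the radii `r > 0` such that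
`w > 0` and `w' < 0 ` on `(0,r)`. -/
def Z1 (w : ℝ → ℝ) : EReal :=
  sSup {z : EReal | ∃ r : ℝ, z = (r : EReal) ∧ 0 < r ∧
    ∀ s : ℝ, 0 < s → s < r → 0 < w s ∧ deriv w s < 0}

/-- The interval `{s | 0 < s < c}` of the reals is open. -/
lemma isOpen_pos_lt_coe (c : EReal) : IsOpen {s : ℝ | 0 < s ∧ (s : EReal) < c} :=
  isOpen_Ioi.inter (isOpen_Iio.preimage continuous_coe_real_ereal)

lemma InCC.abs_lt {c : EReal} {s : ℝ} (h : InCC c s) : ((|s| : ℝ) : EReal) < c := by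
  rcases abs_cases s with ⟨h1, -⟩ | ⟨h1, -⟩
  · rw [h1]; exact h.2
  · rw [h1, EReal.coe_neg]; exact EReal.neg_lt_comm.1 h.1

lemma coe_lt_of_le {c : EReal} {s t : ℝ} (hst : s ≤ t) (ht : (t : EReal) < c) :
    (s : EReal) < c :=
  lt_of_le_of_lt (EReal.coe_le_coe_iff.2 hst) ht

/-- A function whose derivative is integrable near `0` is bounded up to `0`. -/
lemma CondF2.exists_bound {c : EReal} {f : ℝ → ℝ} (hf : CondF2 c f) {M : ℝ}
    (hM : 0 < M) (hMc : (M : EReal) < c) :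
    ∃ K, ∀ s ∈ Ioc 0 M, |f s| ≤ K := by
  obtain ⟨hC, hI⟩ := hf
  have hO := isOpen_pos_lt_coe c
  obtain ⟨s₀, h0, h1, hsM⟩ : ∃ s₀ : ℝ, 0 < s₀ ∧ s₀ < 1 ∧ s₀ ≤ M :=
    ⟨min (1 / 2) M, by positivity, lt_of_le_of_lt (min_le_left _ _) (by norm_num),
      min_le_right _ _⟩
  have hcomp : ContinuousOn f (Icc s₀ M) := hC.continuousOn.mono fun s hs =>
    ⟨h0.trans_le hs.1, coe_lt_of_le hs.2 hMc⟩
  obtain ⟨K₁, hK₁⟩ := isCompact_Icc.exists_bound_of_continuousOn hcomp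
  refine ⟨K₁ + ∫ t in Ioo (0 : ℝ) 1, |deriv f t|, fun s hs => ?_⟩
  have hnn : 0 ≤ ∫ t in Ioo (0 : ℝ) 1, |deriv f t| :=
    integral_nonneg fun t => abs_nonneg (deriv f t)
  rcases le_total s₀ s with h | h
  · have := hK₁ s ⟨h, hs.2⟩
    rw [Real.norm_eq_abs] at this
    linarith
  · have hsub : Ioc s s₀ ⊆ Ioo (0 : ℝ) 1 := fun t ht =>
      ⟨hs.1.trans ht.1, ht.2.trans_lt h1⟩
    have hderiv : ∀ t ∈ uIcc s s₀, HasDerivAt f (deriv f t) t := by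
      intro t ht
      rw [uIcc_of_le h] at ht
      have htm : t ∈ {s : ℝ | 0 < s ∧ (s : EReal) < c} :=
        ⟨hs.1.trans_le ht.1, coe_lt_of_le (ht.2.trans hsM) hMc⟩
      exact ((hC.differentiableOn one_ne_zero).differentiableAt (hO.mem_nhds htm)).hasDerivAt
    have hint : IntervalIntegrable (deriv f) volume s s₀ :=
      (intervalIntegrable_iff_integrableOn_Ioc_of_le h).2 (hI.mono_set hsub)
    have hftc := intervalIntegral.integral_eq_sub_of_hasDerivAt hderiv hint
    have hle : |∫ t in s..s₀, deriv f t| ≤ ∫ t in Ioo (0 : ℝ) 1, |deriv f t| := by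
      rw [intervalIntegral.integral_of_le h]
      refine (norm_integral_le_integral_norm (deriv f)).trans ?_
      exact setIntegral_mono_set hI.norm (ae_of_all _ fun _ => norm_nonneg _)
        (LE.le.eventuallyLE hsub)
    rw [hftc] at hle
    have h2 := hK₁ s₀ ⟨le_rfl, hsM⟩
    rw [Real.norm_eq_abs] at h2
    have h3 : |f s| ≤ |f s₀| + |f s₀ - f s| := by
      have := abs_sub (f s₀) (f s₀ - f s)
      simpa using this
    linarith

lemma CondF1.exists_bound {c : EReal} {f : ℝ → ℝ} {b β : ℝ} (hf1 : CondF1 c f b β)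
    (hf2 : CondF2 c f) {M : ℝ} (hM : 0 < M) (hMc : (M : EReal) < c) :
    ∃ K, ∀ s, |s| ≤ M → |f s| ≤ K := by
  obtain ⟨K, hK⟩ := hf2.exists_bound hM hMc
  refine ⟨K, fun s hs => ?_⟩
  rcases lt_trichotomy s 0 with h | h | h
  · rw [← abs_neg, ← hf1.1 s]
    exact hK _ ⟨by linarith, (neg_le_abs s).trans hs⟩
  · rw [h, hf1.2.1, abs_zero]
    exact (abs_nonneg _).trans (hK M ⟨hM, le_rfl⟩)
  · exact hK _ ⟨h, (le_abs_self s).trans hs⟩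

lemma CondF2.intervalIntegrable {c : EReal} {f : ℝ → ℝ} (hf : CondF2 c f) {M : ℝ}
    (hM : 0 < M) (hMc : (M : EReal) < c) : IntervalIntegrable f volume 0 M := by
  obtain ⟨K, hK⟩ := hf.exists_bound hM hMc
  rw [intervalIntegrable_iff_integrableOn_Ioc_of_le hM.le]
  have hcont : ContinuousOn f (Ioc 0 M) := hf.1.continuousOn.mono fun s hs =>
    ⟨hs.1, coe_lt_of_le hs.2 hMc⟩
  exact IntegrableOn.of_bound (C := K) (by simp)
    (hcont.aestronglyMeasurable measurableSet_Ioc)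
    ((ae_restrict_iff' measurableSet_Ioc).2 (ae_of_all _ fun s hs => hK s hs))

lemma CondF1.intervalIntegrable {c : EReal} {f : ℝ → ℝ} {b β : ℝ} (hf1 : CondF1 c f b β)
    (hf2 : CondF2 c f) {M : ℝ} (hM : 0 < M) (hMc : (M : EReal) < c) :
    IntervalIntegrable f volume (-M) M := by
  have h := hf2.intervalIntegrable hM hMc
  have h' : IntervalIntegrable f volume (-M) 0 := by
    have h2 := (h.comp_sub_left 0).neg
    simp only [zero_sub, sub_zero] at h2
    refine (h2.symm).congr ?_
    intro s _
    simp [hf1.1]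
  exact h'.trans h

lemma CondF1.continuousOn_Fint {c : EReal} {f : ℝ → ℝ} {b β : ℝ} (hf1 : CondF1 c f b β)
    (hf2 : CondF2 c f) {M : ℝ} (hM : 0 < M) (hMc : (M : EReal) < c) :
    ContinuousOn (Fint f) (Icc (-M) M) := by
  have h := hf1.intervalIntegrable hf2 hM hMc
  have := intervalIntegral.continuousOn_primitive_interval' (a := 0) h
    (by rw [uIcc_of_le (by linarith)]; constructor <;> linarith)
  rwa [uIcc_of_le (by linarith)] at this

lemma exists_real_btwn_abs {c : EReal} {s : ℝ} (hs : ((|s| : ℝ) : EReal) < c) :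
    ∃ M : ℝ, |s| < M ∧ 0 < M ∧ (M : EReal) < c := by
  obtain ⟨M, h1, h2⟩ := EReal.lt_iff_exists_real_btwn.1 hs
  have h1' := EReal.coe_lt_coe_iff.1 h1
  exact ⟨M, h1', (abs_nonneg s).trans_lt h1', h2⟩

lemma CondF1.continuousAt_Fint {c : EReal} {f : ℝ → ℝ} {b β : ℝ} (hf1 : CondF1 c f b β)
    (hf2 : CondF2 c f) {s : ℝ} (hs : ((|s| : ℝ) : EReal) < c) :
    ContinuousAt (Fint f) s := by
  obtain ⟨M, h1, h0, hMc⟩ := exists_real_btwn_abs hs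
  exact (hf1.continuousOn_Fint hf2 h0 hMc).continuousAt
    (Icc_mem_nhds (abs_lt.1 h1).1 (abs_lt.1 h1).2)

/-- Continuity of `f` away from `0`, extended by oddness to the negative half-line. -/
lemma CondF1.continuousAt {c : EReal} {f : ℝ → ℝ} {b β : ℝ} (hf1 : CondF1 c f b β)
    (hf2 : CondF2 c f) {s : ℝ} (hs : ((|s| : ℝ) : EReal) < c) (h0 : s ≠ 0) :
    ContinuousAt f s := by
  have key : ∀ t : ℝ, 0 < t → (t : EReal) < c → ContinuousAt f t := fun t h1 h2 =>
    hf2.1.continuousOn.continuousAt ((isOpen_pos_lt_coe c).mem_nhds ⟨h1, h2⟩)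
  rcases lt_or_gt_of_ne h0 with h | h
  · have h1 := key (-s) (by linarith) (by rwa [abs_of_neg h] at hs)
    have h2 : ContinuousAt (fun t => -f (-t)) s :=
      (ContinuousAt.comp (f := fun t : ℝ => -t) h1 continuousAt_neg).neg
    simpa [hf1.1] using h2
  · exact key s h (by rwa [abs_of_pos h] at hs)

lemma CondF1.hasDerivAt_Fint {c : EReal} {f : ℝ → ℝ} {b β : ℝ} (hf1 : CondF1 c f b β)
    (hf2 : CondF2 c f) {s : ℝ} (hs : ((|s| : ℝ) : EReal) < c) (h0 : s ≠ 0) :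
    HasDerivAt (Fint f) (f s) s := by
  obtain ⟨M, h1, hM0, hMc⟩ := exists_real_btwn_abs hs
  have hI := hf1.intervalIntegrable hf2 hM0 hMc
  have hsM := abs_lt.1 h1
  have hsub : uIcc 0 s ⊆ uIcc (-M) M := by
    rw [uIcc_of_le (by linarith : -M ≤ M)]
    exact uIcc_subset_Icc ⟨by linarith, by linarith⟩ ⟨hsM.1.le, hsM.2.le⟩
  refine intervalIntegral.integral_hasDerivAt_right (hI.mono_set hsub) ?_
    (hf1.continuousAt hf2 hs h0)
  refine ⟨Ioc (-M) M, Ioc_mem_nhds hsM.1 hsM.2, ?_⟩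
  exact ((intervalIntegrable_iff_integrableOn_Ioc_of_le (by linarith)).1 hI).aestronglyMeasurable

lemma Fint_abs {f : ℝ → ℝ} (hodd : ∀ s, f (-s) = -f s) (s : ℝ) : Fint f |s| = Fint f s := by
  rcases abs_cases s with ⟨h, -⟩ | ⟨h, -⟩
  · rw [h]
  · rw [h]
    unfold Fint
    have h1 : ∫ t in (0 : ℝ)..s, f (-t) = ∫ t in -s..0, f t := by
      rw [intervalIntegral.integral_comp_neg, neg_zero]
    rw [intervalIntegral.integral_symm, ← h1]
    simp [hodd]

lemma CondF1.Fint_nonpos {c : EReal} {f : ℝ → ℝ} {b β : ℝ} (hf1 : CondF1 c f b β)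
    {s : ℝ} (hs : |s| ≤ b) : Fint f s ≤ 0 := by
  rw [← Fint_abs hf1.1]
  unfold Fint
  rw [intervalIntegral.integral_of_le (abs_nonneg s)]
  exact setIntegral_nonpos measurableSet_Ioc fun t ht =>
    hf1.2.2.2.2.2.2.1 t ⟨ht.1.le, ht.2.trans hs⟩

lemma CondF1.strictMonoOn_Fint {c : EReal} {f : ℝ → ℝ} {b β : ℝ} (hf1 : CondF1 c f b β)
    (hf2 : CondF2 c f) : StrictMonoOn (Fint f) {s | b ≤ s ∧ (s : EReal) < c} := by
  have hb : 0 < b := hf1.2.2.1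
  intro x hx y hy hxy
  have habs : ∀ t ∈ Icc x y, ((|t| : ℝ) : EReal) < c ∧ 0 < t := fun t ht => by
    have h0 : 0 < t := hb.trans_le (hx.1.trans ht.1)
    rw [abs_of_pos h0]
    exact ⟨coe_lt_of_le ht.2 hy.2, h0⟩
  refine strictMonoOn_of_deriv_pos (convex_Icc x y)
    (fun t ht => (hf1.continuousAt_Fint hf2 (habs t ht).1).continuousWithinAt) ?_
    (left_mem_Icc.2 hxy.le) (right_mem_Icc.2 hxy.le) hxy
  intro t ht
  rw [interior_Icc] at ht
  have h := habs t (Ioo_subset_Icc_self ht)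
  rw [(hf1.hasDerivAt_Fint hf2 h.1 h.2.ne').deriv]
  exact hf1.2.2.2.2.2.1 t (hx.1.trans_lt ht.1) (coe_lt_of_le ht.2.le hy.2)

lemma CondF1.abs_le_max {c : EReal} {f : ℝ → ℝ} {b β : ℝ} (hf1 : CondF1 c f b β)
    (hf2 : CondF2 c f) {s t : ℝ} (hs : InCC c s) (ht : InCC c t)
    (hle : Fint f s ≤ Fint f t) : |s| ≤ max |t| β := by
  have hmono := hf1.strictMonoOn_Fint hf2
  obtain ⟨hodd, -, -, hbβ, hβc, -, -, -, hFβ⟩ := id hf1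
  by_contra! hlt
  rw [max_lt_iff] at hlt
  rw [← Fint_abs hodd s, ← Fint_abs hodd t] at hle
  have hβs := hmono ⟨hbβ.le, hβc⟩ ⟨(hbβ.trans hlt.2).le, hs.abs_lt⟩ hlt.2
  rcases le_total |t| b with h | h
  · have := hf1.Fint_nonpos (s := |t|) (by rwa [abs_abs])
    linarith
  · have := hmono ⟨h, ht.abs_lt⟩ ⟨h.trans hlt.1.le, hs.abs_lt⟩ hlt.1
    linarith

/-- The energy `u'² / 2 + F(u)` of a function `u`. -/
def energy (f u : ℝ → ℝ) (r : ℝ) : ℝ := deriv u r ^ 2 / 2 + Fint f (u r)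

section Solution

variable {c : EReal} {f q u : ℝ → ℝ} {b β : ℝ}

lemma IsSolutionE.hasDerivAt (hu : IsSolutionE c f q u) {r : ℝ} (hr : 0 < r) :
    HasDerivAt u (deriv u r) r :=
  ((hu.c1.differentiableOn one_ne_zero).differentiableAt (Ici_mem_nhds hr)).hasDerivAt

lemma IsSolutionE.continuousAt_energy (hu : IsSolutionE c f q u) (hf1 : CondF1 c f b β)
    (hf2 : CondF2 c f) {r : ℝ} (hr : 0 < r) : ContinuousAt (energy f u) r := by
  have h1 : ContinuousAt (fun x => deriv u x ^ 2 / 2) r :=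
    ((hu.diff2 r hr).continuousAt.pow 2).div_const 2
  have h2 : ContinuousAt (fun x => Fint f (u x)) r :=
    ContinuousAt.comp (f := u) (hf1.continuousAt_Fint hf2 (hu.mem r hr.le).abs_lt)
      (hu.hasDerivAt hr).continuousAt
  exact h1.add h2

lemma IsSolutionE.eventually_slope_energy_lt (hu : IsSolutionE c f q u)
    (hf1 : CondF1 c f b β) (hf2 : CondF2 c f) (hq1 : CondQ1 q) {x r : ℝ} (hx : 0 < x)
    (hr : 0 < r) : ∀ᶠ z in 𝓝[>] x, slope (energy f u) x z < r := by
  have hux := hu.hasDerivAt hx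
  have hode := hu.ode x hx
  have hfric : 0 ≤ deriv q x / q x * deriv u x ^ 2 := by
    have := hq1.2.1 x hx
    have h1 := this.1
    have h2 := this.2
    positivity
  have hkin : HasDerivAt (fun t => deriv u t ^ 2 / 2) (deriv u x * deriv (deriv u) x) x := by
    refine (((hu.diff2 x hx).hasDerivAt.pow 2).div_const 2).congr_deriv ?_
    norm_num
    ring
  have hmono : 𝓝[>] x ≤ 𝓝[≠] x := nhdsWithin_mono x fun z hz => ne_of_gt hz
  by_cases h0 : u x = 0
  · have hslope := (hasDerivAt_iff_tendsto_slope.1 hkin).mono_left hmono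
    have hlt : deriv u x * deriv (deriv u) x < r := by
      rw [h0, hf1.2.1] at hode
      have : deriv u x * deriv (deriv u) x = -(deriv q x / q x * deriv u x ^ 2) := by
        linear_combination deriv u x * hode
      linarith
    have hsmall : ∀ᶠ z in 𝓝[>] x, |u z| < b := by
      have h1 : Tendsto (fun z => |u z|) (𝓝[>] x) (𝓝 |u x|) :=
        hux.continuousAt.abs.tendsto.mono_left nhdsWithin_le_nhds
      rw [h0, abs_zero] at h1
      exact h1.eventually_lt_const hf1.2.2.1
    filter_upwards [hslope.eventually_lt_const hlt, hsmall, self_mem_nhdsWithin] with z h1 h2 hz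
    refine lt_of_le_of_lt ?_ h1
    have hF := hf1.Fint_nonpos h2.le
    have hz' : 0 < z - x := sub_pos.2 hz
    have hF0 : Fint f (u x) = 0 := by rw [h0]; simp [Fint]
    rw [slope_def_field, slope_def_field]
    unfold energy
    rw [hF0]
    exact div_le_div_of_nonneg_right (by linarith) hz'.le
  · have hpot : HasDerivAt (fun t => Fint f (u t)) (f (u x) * deriv u x) x :=
      HasDerivAt.comp x (hf1.hasDerivAt_Fint hf2 (hu.mem x hx.le).abs_lt h0) hux
    have hslope := (hasDerivAt_iff_tendsto_slope.1 (hkin.add hpot)).mono_left hmono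
    refine hslope.eventually_lt_const ?_
    have : deriv u x * deriv (deriv u) x + f (u x) * deriv u x
        = -(deriv q x / q x * deriv u x ^ 2) := by
      linear_combination deriv u x * hode
    linarith

lemma IsSolutionE.antitoneOn_energy (hu : IsSolutionE c f q u) (hf1 : CondF1 c f b β)
    (hf2 : CondF2 c f) (hq1 : CondQ1 q) : AntitoneOn (energy f u) (Ioi 0) := by
  intro x hx y _ hxy
  have hx : 0 < x := hx
  refine image_le_of_liminf_slope_right_le_deriv_boundary (B := fun _ => energy f u x)
    (B' := fun _ => 0)
    (fun t ht => (hu.continuousAt_energy hf1 hf2 (hx.trans_le ht.1)).continuousWithinAt)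
    le_rfl continuousOn_const (fun t _ => hasDerivWithinAt_const _ _ _) ?_ (right_mem_Icc.2 hxy)
  intro t ht r hr
  exact (hu.eventually_slope_energy_lt hf1 hf2 hq1 (hx.trans_le ht.1) hr).frequently

/-- The derivative of a solution vanishes at the origin, as a one-sided limit. -/
lemma IsSolutionE.tendsto_deriv_zero (hu : IsSolutionE c f q u) (hf1 : CondF1 c f b β)
    (hf2 : CondF2 c f) (hq1 : CondQ1 q) : Tendsto (deriv u) (𝓝[>] 0) (𝓝 0) := by
  obtain ⟨hqC, hqpos, hq0, hqc⟩ := hq1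
  obtain ⟨M, hM1, hM0, hMc⟩ := exists_real_btwn_abs (hu.mem 0 le_rfl).abs_lt
  obtain ⟨K, hK⟩ := hf1.exists_bound hf2 hM0 hMc
  have hqd : ∀ r, 0 < r → HasDerivAt q (deriv q r) r := fun r hr =>
    ((hqC.differentiableOn one_ne_zero).differentiableAt (Ioi_mem_nhds hr)).hasDerivAt
  have hqcont : ContinuousOn q (Ici 0) := by
    intro r hr
    rcases (mem_Ici.1 hr).eq_or_lt with h | h
    · rw [← h]; exact hqc
    · exact (hqd r h).continuousAt.continuousWithinAt
  have hqmono : StrictMonoOn q (Ici 0) := by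
    refine strictMonoOn_of_deriv_pos (convex_Ici 0) hqcont fun r hr => ?_
    rw [interior_Ici] at hr
    exact (hqpos r hr).2
  set v := derivWithin u (Ici 0) with hv
  have hvcont : ContinuousOn v (Ici 0) :=
    hu.c1.continuousOn_derivWithin (uniqueDiffOn_Ici 0) le_rfl
  have hvd : ∀ r, 0 < r → v r = deriv u r := fun r hr =>
    derivWithin_of_mem_nhds (Ici_mem_nhds hr)
  have hflux : ∀ r, 0 < r → HasDerivAt (fun t => q t * v t) (-(q r * f (u r))) r := by
    intro r hr
    have h := (hqd r hr).mul (hu.diff2 r hr).hasDerivAt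
    have hode := hu.ode r hr
    have hqr := (hqpos r hr).1
    have heq : deriv q r * deriv u r + q r * deriv (deriv u) r = -(q r * f (u r)) := by
      field_simp at hode
      linarith
    rw [heq] at h
    refine h.congr_of_eventuallyEq ?_
    filter_upwards [Ioi_mem_nhds hr] with t ht
    rw [hvd t ht]; rfl
  have hsmall : ∀ᶠ z in 𝓝[≥] (0 : ℝ), |u z| < M :=
    (hu.c1.continuousOn 0 self_mem_Ici).abs.eventually_lt_const hM1
  obtain ⟨δ, hδ, hδM⟩ := mem_nhdsGE_iff_exists_Ico_subset.1 hsmall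
  have hbound : ∀ r ∈ Ioo 0 δ, |deriv u r| ≤ K * r := by
    intro r hr
    obtain ⟨ξ, hξ, hslope⟩ := exists_hasDerivAt_eq_slope (fun t => q t * v t)
      (fun r => -(q r * f (u r))) hr.1
      ((hqcont.mul hvcont).mono Icc_subset_Ici_self) (fun t ht => hflux t ht.1)
    have hqr := (hqpos r hr.1).1
    have hqξ := (hqpos ξ hξ.1).1
    have hr0 := hr.1
    rw [hq0, zero_mul, sub_zero, sub_zero, hvd r hr.1, eq_div_iff hr0.ne'] at hslope
    have hfξ : |f (u ξ)| ≤ K :=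
      hK _ (le_of_lt (hδM ⟨hξ.1.le, hξ.2.trans hr.2⟩))
    have hqle : q ξ ≤ q r := (hqmono (mem_Ici.2 hξ.1.le) (mem_Ici.2 hr0.le) hξ.2).le
    have habs : q r * |deriv u r| = q ξ * |f (u ξ)| * r := by
      rw [← abs_of_pos hqr, ← abs_mul, ← hslope, abs_mul, abs_neg, abs_mul, abs_of_pos hqξ,
        abs_of_pos hr0]
    have hle : q r * |deriv u r| ≤ q r * (K * r) := by
      rw [habs, ← mul_assoc]
      gcongr
    exact le_of_mul_le_mul_left hle hqr
  refine squeeze_zero_norm' (a := fun r => K * r) ?_ ?_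
  · filter_upwards [Ioo_mem_nhdsGT hδ] with r hr using hbound r hr
  · have : Tendsto (fun r : ℝ => K * r) (𝓝 0) (𝓝 (K * 0)) := tendsto_id.const_mul K
    rw [mul_zero] at this
    exact this.mono_left nhdsWithin_le_nhds

lemma IsSolutionE.energy_le (hu : IsSolutionE c f q u) (hf1 : CondF1 c f b β)
    (hf2 : CondF2 c f) (hq1 : CondQ1 q) {r : ℝ} (hr : 0 < r) :
    energy f u r ≤ Fint f (u 0) := by
  have h1 : Tendsto u (𝓝[>] 0) (𝓝 (u 0)) :=
    (hu.c1.continuousOn 0 self_mem_Ici).tendsto.mono_left (nhdsWithin_mono 0 Ioi_subset_Ici_self)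
  have h2 : Tendsto (fun t => Fint f (u t)) (𝓝[>] 0) (𝓝 (Fint f (u 0))) :=
    (hf1.continuousAt_Fint hf2 (hu.mem 0 le_rfl).abs_lt).tendsto.comp h1
  have h3 : Tendsto (energy f u) (𝓝[>] 0) (𝓝 (Fint f (u 0))) := by
    have h := (((hu.tendsto_deriv_zero hf1 hf2 hq1).pow 2).div_const 2).add h2
    rwa [zero_pow two_ne_zero, zero_div, zero_add] at h
  refine ge_of_tendsto h3 ?_
  filter_upwards [Ioc_mem_nhdsGT hr] with t ht
  exact hu.antitoneOn_energy hf1 hf2 hq1 ht.1 hr ht.2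

end Solution

/-- A solution of (E) has `|u| + |u'|` globally bounded on `[0,∞)`. -/
theorem solution_bounded
    (c : EReal) (f q : ℝ → ℝ) (b β : ℝ) (hc : 0 < c)
    (hf1 : CondF1 c f b β) (hf2 : CondF2 c f)
    (hq1 : CondQ1 q) (hq2 : CondQ2 q)
    (u : ℝ → ℝ) (hu : IsSolutionE c f q u) :
    ∃ C : ℝ, 0 < C ∧ ∀ r : ℝ, 0 ≤ r → |u r| + |deriv u r| ≤ C := by
  obtain ⟨hodd, -, hb, hbβ, hβc, -⟩ := id hf1
  set M := max |u 0| β with hMdef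
  have hM0 : 0 < M := (hb.trans hbβ).trans_le (le_max_right _ _)
  have hMc : (M : EReal) < c := by
    rcases max_choice |u 0| β with h | h
    · rw [hMdef, h]; exact (hu.mem 0 le_rfl).abs_lt
    · rw [hMdef, h]; exact hβc
  obtain ⟨K, hK⟩ :=
    isCompact_Icc.exists_bound_of_continuousOn (hf1.continuousOn_Fint hf2 hM0 hMc)
  have hK' : ∀ s, |s| ≤ M → |Fint f s| ≤ K := fun s hs => hK s (abs_le.1 hs)
  have hu0 : |u 0| ≤ M := le_max_left _ _
  have hK0 : 0 ≤ K := (abs_nonneg _).trans (hK' _ hu0)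
  refine ⟨M + (4 * K + 1), by positivity, fun r hr => ?_⟩
  rcases hr.eq_or_lt with rfl | hr
  · rw [hu.d0, abs_zero]
    linarith
  have hE := hu.energy_le hf1 hf2 hq1 hr
  unfold energy at hE
  have hur : |u r| ≤ M := hf1.abs_le_max hf2 (hu.mem r hr.le) (hu.mem 0 le_rfl)
    (by nlinarith [sq_nonneg (deriv u r)])
  have h1 := abs_le.1 (hK' _ hu0)
  have h2 := abs_le.1 (hK' _ hur)
  have h3 : |deriv u r| ≤ 4 * K + 1 := by
    refine abs_le_of_sq_le_sq (b := 4 * K + 1) ?_ (by positivity)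
    nlinarith
  linarith
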